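/- arXiv:2106.15892 — 4 statements merged into one kernel-verified Lean document; each statement's English description precedes it below -/
import Mathlib

section
/- Let A₀ = (Q₀, Σ, δ₀, I₀, α₀) and A₁ = (Q₁, Σ, δ₁, I₁, α₁) be complete TELA with disjoint state spaces whose acceptance conditions are generalized Büchi conditions with the same number of acceptance sets, α_i = Inf(T₁^i) ∧ … ∧ Inf(T_k^i) for i ∈ {0,1}. Then L(A₀ ⊕_GBA A₁) = L(A₀) ∪ L(A₁). -/
namespace TELAFormal

variable {Q A : Type}

/-- Symbolic acceptance conditions of transition-based Emerson-Lei automata: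
`tt | ff | Inf(T) | Fin(T) | α ∨ α | α ∧ α` with `T` a set of transitions. -/
inductive AccCond (Q A : Type) : Type where
  | tt : AccCond Q A
  | ff : AccCond Q A
  | inf (T : Set (Q × A × Q)) : AccCond Q A
  | fin (T : Set (Q × A × Q)) : AccCond Q A
  | disj (a b : AccCond Q A) : AccCond Q A
  | conj (a b : AccCond Q A) : AccCond Q A

/-- Satisfaction of an acceptance condition by a set of transitions. -/
def AccCond.sat (T : Set (Q × A × Q)) : AccCond Q A → Prop
  | .tt => True
  | .ff => False
  | .inf S => (T ∩ S).Nonempty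
  | .fin S => T ∩ S = ∅
  | .disj a b => a.sat T ∨ b.sat T
  | .conj a b => a.sat T ∧ b.sat T

/-- All transition sets occurring in the condition are subsets of `δ`. -/
def AccCond.wf (δ : Set (Q × A × Q)) : AccCond Q A → Prop
  | .tt => True
  | .ff => True
  | .inf S => S ⊆ δ
  | .fin S => S ⊆ δ
  | .disj a b => a.wf δ ∧ b.wf δ
  | .conj a b => a.wf δ ∧ b.wf δ

/-- A transition-based Emerson-Lei automaton (TELA) over state type `Q` and
alphabet `A`: a transition relation, a set of initial states and an
acceptance condition. -/
structure TELA (Q A : Type) where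
  delta : Set (Q × A × Q)
  init : Set Q
  acc : AccCond Q A

/-- `ρ` is a run of `M` on the infinite word `u`. -/
def TELA.IsRun (M : TELA Q A) (u : ℕ → A) (ρ : ℕ → Q × A × Q) : Prop :=
  (ρ 0).1 ∈ M.init ∧ ∀ n, ρ n ∈ M.delta ∧ (ρ n).2.1 = u n ∧ (ρ n).2.2 = (ρ (n+1)).1

/-- The set of transitions occurring infinitely often in `ρ`. -/
def infOcc (ρ : ℕ → Q × A × Q) : Set (Q × A × Q) :=
  {t | ∀ N, ∃ n, N ≤ n ∧ ρ n = t}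

/-- The language of a TELA: all infinite words admitting an accepting run. -/
def TELA.Lang (M : TELA Q A) : Set (ℕ → A) :=
  {u | ∃ ρ, M.IsRun u ρ ∧ AccCond.sat (infOcc ρ) M.acc}

/-- `bigOrN f m = f 1 ∨ f 2 ∨ … ∨ f m` (left-associated, `ff` for `m = 0`). -/
def bigOrN (f : ℕ → AccCond Q A) : ℕ → AccCond Q A
  | 0 => .ff
  | 1 => f 1
  | n+2 => .disj (bigOrN f (n+1)) (f (n+2))

/-- `infConj T k = Inf(T 1) ∧ … ∧ Inf(T k)` (left-associated, `tt` for `k = 0`):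
a generalized Büchi condition with acceptance sets `T 1, …, T k`. -/
def infConj (T : ℕ → Set (Q × A × Q)) : ℕ → AccCond Q A
  | 0 => .tt
  | 1 => .inf (T 1)
  | n+2 => .conj (infConj T (n+1)) (.inf (T (n+2)))

/-- The DNF acceptance condition `⋁_{1 ≤ i ≤ m} (Fin(T i 0) ∧ ⋀_{1 ≤ j ≤ k i} Inf(T i j))`. -/
def dnfAcc (m : ℕ) (k : ℕ → ℕ) (T : ℕ → ℕ → Set (Q × A × Q)) : AccCond Q A :=
  bigOrN (fun i => .conj (.fin (T i 0)) (infConj (T i) (k i))) m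

/-- Lift a state map to a map on transitions. -/
def liftTr {Q Q' A : Type} (f : Q → Q') (t : Q × A × Q) : Q' × A × Q' :=
  (f t.1, t.2.1, f t.2.2)

/-- Apply a transition map to all transition sets occurring in a condition. -/
def AccCond.map {Q Q' A : Type} (f : Q × A × Q → Q' × A × Q') :
    AccCond Q A → AccCond Q' A
  | .tt => .tt
  | .ff => .ff
  | .inf S => .inf (f '' S)
  | .fin S => .fin (f '' S)
  | .disj a b => .disj (a.map f) (b.map f)
  | .conj a b => .conj (a.map f) (b.map f)

/-- A TELA is complete if every state has an `a`-successor for every letter `a`. -/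
def TELA.Complete (M : TELA Q A) : Prop :=
  ∀ q a, ∃ q', (q, a, q') ∈ M.delta

/-- A TELA is deterministic if it has exactly one initial state and the
transition relation is a function `Q × A → Q`. -/
def TELA.Deterministic (M : TELA Q A) : Prop :=
  (∃ q₀, M.init = {q₀}) ∧ ∀ q a, ∃! q', (q, a, q') ∈ M.delta

/-- A TELA is limit-deterministic: there is a partition of the states into
`QD` and its complement `Q_N` such that (1) no transition leaves `QD`,
(2) states in `QD` have at most one `a`-successor for every `a`, and
(3) every accepting run eventually stops using transitions inside `Q_N`. -/
def TELA.LimitDet (M : TELA Q A) : Prop :=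
  ∃ QD : Set Q,
    (∀ t ∈ M.delta, t.1 ∈ QD → t.2.2 ∈ QD) ∧
    (∀ q ∈ QD, ∀ a q₁ q₂, (q, a, q₁) ∈ M.delta → (q, a, q₂) ∈ M.delta → q₁ = q₂) ∧
    (∀ u ρ, M.IsRun u ρ → AccCond.sat (infOcc ρ) M.acc →
      infOcc ρ ∩ {t | t.1 ∉ QD ∧ t.2.2 ∉ QD} = ∅)

theorem sat_infConj_iff {Q A : Type} (S : Set (Q × A × Q)) (T : ℕ → Set (Q × A × Q)) :
    ∀ k, (infConj T k).sat S ↔ ∀ j, 1 ≤ j → j ≤ k → (S ∩ T j).Nonempty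
  | 0 => by
    simp only [infConj, AccCond.sat, true_iff]
    intro j h₁ h₂
    omega
  | 1 => by
    simp only [infConj, AccCond.sat]
    refine ⟨fun h j h₁ h₂ => ?_, fun h => h 1 le_rfl le_rfl⟩
    obtain rfl : j = 1 := by omega
    exact h
  | n + 2 => by
    simp only [infConj, AccCond.sat, sat_infConj_iff S T (n + 1)]
    refine ⟨fun h j h₁ h₂ => ?_,
      fun h => ⟨fun j h₁ h₂ => h j h₁ (by omega), h (n + 2) (by omega) le_rfl⟩⟩
    rcases Nat.lt_or_ge j (n + 2) with hj | hj
    · exact h.1 j h₁ (by omega)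
    · obtain rfl : j = n + 2 := by omega
      exact h.2

theorem liftTr_injective {Q Q' A : Type} {f : Q → Q'} (hf : f.Injective) :
    (liftTr (A := A) f).Injective := by
  rintro ⟨p, a, q⟩ ⟨p', a', q'⟩ h
  simp only [liftTr, Prod.mk.injEq] at h ⊢
  exact ⟨hf h.1, h.2.1, hf h.2.2⟩

theorem infOcc_comp {Q Q' A : Type} {g : Q × A × Q → Q' × A × Q'} (hg : g.Injective)
    (ρ : ℕ → Q × A × Q) : infOcc (g ∘ ρ) = g '' infOcc ρ := by
  ext t
  constructor
  · intro h
    obtain ⟨n, -, rfl⟩ := h 0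
    refine ⟨ρ n, fun N => ?_, rfl⟩
    obtain ⟨m, hm, h⟩ := h N
    exact ⟨m, hm, hg h⟩
  · rintro ⟨s, hs, rfl⟩ N
    obtain ⟨m, hm, rfl⟩ := hs N
    exact ⟨m, hm, rfl⟩

theorem sat_infConj_infOcc_comp_iff {Q Q' A : Type} {g : Q × A × Q → Q' × A × Q'}
    (hg : g.Injective) {T : ℕ → Set (Q × A × Q)} {T' : ℕ → Set (Q' × A × Q')}
    (hT : ∀ j, g ⁻¹' T' j = T j) (ρ : ℕ → Q × A × Q) (k : ℕ) :
    (infConj T' k).sat (infOcc (g ∘ ρ)) ↔ (infConj T k).sat (infOcc ρ) := by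
  simp only [sat_infConj_iff, infOcc_comp hg, ← hT, ← Set.image_inter_preimage,
    Set.image_nonempty]

theorem TELA.isRun_liftTr_comp_iff {Q Q' A : Type} {f : Q → Q'} (hf : f.Injective)
    {M : TELA Q A} {M' : TELA Q' A} (hδ : liftTr f ⁻¹' M'.delta = M.delta)
    (hI : f ⁻¹' M'.init = M.init) (u : ℕ → A) (ρ : ℕ → Q × A × Q) :
    M'.IsRun u (liftTr f ∘ ρ) ↔ M.IsRun u ρ := by
  simp only [TELA.IsRun, ← hδ, ← hI, Set.mem_preimage, Function.comp_apply, liftTr, hf.eq_iff]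

/-- If no transition leaves the range of `f`, a run starting in that range is the lift of a
sequence of transitions. -/
theorem TELA.IsRun.exists_eq_liftTr_comp {Q Q' A : Type} {f : Q → Q'} {M' : TELA Q' A}
    (hM : ∀ t ∈ M'.delta, t.1 ∈ Set.range f → t ∈ Set.range (liftTr f)) {u : ℕ → A}
    {ρ : ℕ → Q' × A × Q'} (hρ : M'.IsRun u ρ) (h₀ : (ρ 0).1 ∈ Set.range f) :
    ∃ σ : ℕ → Q × A × Q, liftTr f ∘ σ = ρ := by
  have hsrc : ∀ n, (ρ n).1 ∈ Set.range f := by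
    intro n
    induction n with
    | zero => exact h₀
    | succ n ih =>
      obtain ⟨t, ht⟩ := hM _ (hρ.2 n).1 ih
      rw [← (hρ.2 n).2.2, ← ht]
      exact ⟨_, rfl⟩
  choose σ hσ using fun n => hM _ (hρ.2 n).1 (hsrc n)
  exact ⟨σ, funext hσ⟩

theorem liftTr_inl_preimage {Q₀ Q₁ A : Type} (S₀ : Set (Q₀ × A × Q₀)) (S₁ : Set (Q₁ × A × Q₁)) :
    liftTr (Sum.inl : Q₀ → Q₀ ⊕ Q₁) ⁻¹' (liftTr Sum.inl '' S₀ ∪ liftTr Sum.inr '' S₁) = S₀ := by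
  ext ⟨p, a, q⟩
  simp [liftTr]

theorem liftTr_inr_preimage {Q₀ Q₁ A : Type} (S₀ : Set (Q₀ × A × Q₀)) (S₁ : Set (Q₁ × A × Q₁)) :
    liftTr (Sum.inr : Q₁ → Q₀ ⊕ Q₁) ⁻¹' (liftTr Sum.inl '' S₀ ∪ liftTr Sum.inr '' S₁) = S₁ := by
  ext ⟨p, a, q⟩
  simp [liftTr]

/-- For complete TELA `A₀`, `A₁` with disjoint state spaces
(realized by the sum type) and generalized Büchi acceptance conditions with the
same number `k` of acceptance sets, the GBA-specific sum
`A₀ ⊕_GBA A₁ = (Q₀∪Q₁, Σ, δ₀∪δ₁, I₀∪I₁, Inf(T₁⁰∪T₁¹) ∧ … ∧ Inf(T_k⁰∪T_k¹))`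
satisfies `L(A₀ ⊕_GBA A₁) = L(A₀) ∪ L(A₁)`. -/
theorem lang_gbaSum {Q₀ Q₁ A : Type} [Finite Q₀] [Finite Q₁] [Finite A]
    (δ₀ : Set (Q₀ × A × Q₀)) (I₀ : Set Q₀) (T₀ : ℕ → Set (Q₀ × A × Q₀))
    (δ₁ : Set (Q₁ × A × Q₁)) (I₁ : Set Q₁) (T₁ : ℕ → Set (Q₁ × A × Q₁))
    (k : ℕ) (hk : 1 ≤ k)
    (hT₀ : ∀ j, 1 ≤ j → j ≤ k → T₀ j ⊆ δ₀)
    (hT₁ : ∀ j, 1 ≤ j → j ≤ k → T₁ j ⊆ δ₁)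
    (hc₀ : TELA.Complete ⟨δ₀, I₀, infConj T₀ k⟩)
    (hc₁ : TELA.Complete ⟨δ₁, I₁, infConj T₁ k⟩) :
    TELA.Lang ⟨liftTr Sum.inl '' δ₀ ∪ liftTr Sum.inr '' δ₁,
               Sum.inl '' I₀ ∪ Sum.inr '' I₁,
               infConj (fun j => liftTr Sum.inl '' T₀ j ∪ liftTr Sum.inr '' T₁ j) k⟩
      = TELA.Lang ⟨δ₀, I₀, infConj T₀ k⟩ ∪ TELA.Lang ⟨δ₁, I₁, infConj T₁ k⟩ := by
  set M : TELA (Q₀ ⊕ Q₁) A := ⟨liftTr Sum.inl '' δ₀ ∪ liftTr Sum.inr '' δ₁,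
    Sum.inl '' I₀ ∪ Sum.inr '' I₁,
    infConj (fun j => liftTr Sum.inl '' T₀ j ∪ liftTr Sum.inr '' T₁ j) k⟩ with hM
  have run₀ := TELA.isRun_liftTr_comp_iff (M := ⟨δ₀, I₀, infConj T₀ k⟩) (M' := M)
    Sum.inl_injective (liftTr_inl_preimage δ₀ δ₁) (by ext; simp [hM])
  have run₁ := TELA.isRun_liftTr_comp_iff (M := ⟨δ₁, I₁, infConj T₁ k⟩) (M' := M)
    Sum.inr_injective (liftTr_inr_preimage δ₀ δ₁) (by ext; simp [hM])
  have acc₀ := fun ρ => sat_infConj_infOcc_comp_iff (liftTr_injective Sum.inl_injective)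
    (fun j => liftTr_inl_preimage (T₀ j) (T₁ j)) ρ k
  have acc₁ := fun ρ => sat_infConj_infOcc_comp_iff (liftTr_injective Sum.inr_injective)
    (fun j => liftTr_inr_preimage (T₀ j) (T₁ j)) ρ k
  ext u
  constructor
  · rintro ⟨ρ, hρ, hacc⟩
    rcases hρ.1 with ⟨q, -, hq⟩ | ⟨q, -, hq⟩
    · obtain ⟨σ, rfl⟩ := hρ.exists_eq_liftTr_comp (f := Sum.inl)
        (by rintro _ (⟨t, -, rfl⟩ | ⟨t, -, rfl⟩) <;> simp [liftTr]) ⟨q, hq⟩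
      exact Or.inl ⟨σ, (run₀ u σ).1 hρ, (acc₀ σ).1 hacc⟩
    · obtain ⟨σ, rfl⟩ := hρ.exists_eq_liftTr_comp (f := Sum.inr)
        (by rintro _ (⟨t, -, rfl⟩ | ⟨t, -, rfl⟩) <;> simp [liftTr]) ⟨q, hq⟩
      exact Or.inr ⟨σ, (run₁ u σ).1 hρ, (acc₁ σ).1 hacc⟩
  · rintro (⟨σ, hσ, hacc⟩ | ⟨σ, hσ, hacc⟩)
    · exact ⟨_, (run₀ u σ).2 hσ, (acc₀ σ).2 hacc⟩
    · exact ⟨_, (run₁ u σ).2 hσ, (acc₁ σ).2 hacc⟩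

end TELAFormal
end

section
/- Let A = (Q, Σ, δ, I, α) be a TELA in DNF. Then L(A) = L(removeFin(A)). -/
namespace TELAFormal

variable {Q A : Type}

section RemoveFin

/-- States of `removeFin(A)`: the main copy `Q` plus one tagged copy `(i, q)`
of `Q` per disjunct `i`. -/
abbrev RFQ (Q : Type) := Q ⊕ (ℕ × Q)

/-- `δ_i`: the `i`-th copy of `δ` with the transitions of `T i 0` removed. -/
def copyDelta (δ : Set (Q × A × Q)) (T : ℕ → ℕ → Set (Q × A × Q)) (i : ℕ) :
    Set (RFQ Q × A × RFQ Q) :=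
  {t | ∃ q a q', (q, a, q') ∈ δ \ T i 0 ∧ t = (Sum.inr (i, q), a, Sum.inr (i, q'))}

/-- `U i j`: the copy of `T i j ∖ T i 0` inside the `i`-th copy. -/
def copyU (T : ℕ → ℕ → Set (Q × A × Q)) (i j : ℕ) : Set (RFQ Q × A × RFQ Q) :=
  {t | ∃ q a q', (q, a, q') ∈ T i j \ T i 0 ∧ t = (Sum.inr (i, q), a, Sum.inr (i, q'))}

/-- The transitions `{(q, a, q'^(i)) | (q,a,q') ∈ δ}` from the main copy into copy `i`. -/
def copyBridge (δ : Set (Q × A × Q)) (i : ℕ) : Set (RFQ Q × A × RFQ Q) :=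
  {t | ∃ q a q', (q, a, q') ∈ δ ∧ t = (Sum.inl q, a, Sum.inr (i, q'))}

/-- The transition relation `δ'` of `removeFin(A)`. -/
def rfDelta (δ : Set (Q × A × Q)) (T : ℕ → ℕ → Set (Q × A × Q)) (m : ℕ) :
    Set (RFQ Q × A × RFQ Q) :=
  liftTr Sum.inl '' δ ∪
    ⋃ i ∈ Finset.Icc 1 m, (copyDelta δ T i ∪ copyBridge δ i)

/-- `φ_i = ⋀_{1 ≤ j ≤ k i} Inf(U i j)`. -/
def rfPhi (T : ℕ → ℕ → Set (Q × A × Q)) (k : ℕ → ℕ) (i : ℕ) : AccCond (RFQ Q) A :=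
  infConj (fun j => copyU T i j) (k i)

/-- `removeFin(A)` with acceptance `α' = ⋁_{1 ≤ i ≤ m} φ_i`. -/
def removeFin (δ : Set (Q × A × Q)) (T : ℕ → ℕ → Set (Q × A × Q))
    (I : Set Q) (m : ℕ) (k : ℕ → ℕ) : TELA (RFQ Q) A :=
  ⟨rfDelta δ T m, Sum.inl '' I, bigOrN (fun i => rfPhi T k i) m⟩

/-- `removeFin_GBA(A)` with acceptance
`α'' = ⋀_{1 ≤ j ≤ k} Inf(U 1 j ∪ … ∪ U m j)`, where `k = maxᵢ k i` and
`U i j := δ_i` for `k i < j ≤ k`. -/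
def removeFinGBA (δ : Set (Q × A × Q)) (T : ℕ → ℕ → Set (Q × A × Q))
    (I : Set Q) (m : ℕ) (k : ℕ → ℕ) : TELA (RFQ Q) A :=
  ⟨rfDelta δ T m, Sum.inl '' I,
   infConj
     (fun j => ⋃ i ∈ Finset.Icc 1 m,
       (if j ≤ k i then copyU T i j else copyDelta δ T i))
     ((Finset.Icc 1 m).sup k)⟩

end RemoveFin

theorem sat_bigOrN {Q A : Type} (X : Set (Q × A × Q)) (f : ℕ → AccCond Q A) (m : ℕ) :
    (bigOrN f m).sat X ↔ ∃ i, 1 ≤ i ∧ i ≤ m ∧ (f i).sat X := by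
  induction m using bigOrN.induct with
  | case1 => simp only [bigOrN, AccCond.sat]; grind
  | case2 =>
    simp only [bigOrN]
    exact ⟨fun h => ⟨1, le_rfl, le_rfl, h⟩, fun ⟨i, h₁, h₂, h⟩ => le_antisymm h₂ h₁ ▸ h⟩
  | case3 n ih =>
    simp only [bigOrN, AccCond.sat, ih]
    constructor
    · rintro (⟨i, h₁, h₂, h⟩ | h)
      · exact ⟨i, h₁, by omega, h⟩
      · exact ⟨n + 2, by omega, le_rfl, h⟩
    · rintro ⟨i, h₁, h₂, h⟩
      rcases h₂.lt_or_eq with h₃ | rfl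
      · exact Or.inl ⟨i, h₁, by omega, h⟩
      · exact Or.inr h

theorem sat_infConj {Q A : Type} (X : Set (Q × A × Q)) (T : ℕ → Set (Q × A × Q)) (k : ℕ) :
    (infConj T k).sat X ↔ ∀ j, 1 ≤ j → j ≤ k → (X ∩ T j).Nonempty := by
  induction k using infConj.induct with
  | case1 => simp only [infConj, AccCond.sat]; grind
  | case2 =>
    simp only [infConj, AccCond.sat]
    exact ⟨fun h j h₁ h₂ => le_antisymm h₂ h₁ ▸ h, fun h => h 1 le_rfl le_rfl⟩
  | case3 n ih =>
    simp only [infConj, AccCond.sat, ih]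
    constructor
    · rintro ⟨h, h'⟩ j h₁ h₂
      rcases h₂.lt_or_eq with h₃ | rfl
      · exact h j h₁ (by omega)
      · exact h'
    · exact fun h => ⟨fun j h₁ h₂ => h j h₁ (by omega), h (n + 2) (by omega) le_rfl⟩

theorem exists_forall_ge_notMem_of_infOcc_inter_eq_empty {Q A : Type} [Finite Q] [Finite A]
    {ρ : ℕ → Q × A × Q} {S : Set (Q × A × Q)} (h : infOcc ρ ∩ S = ∅) :
    ∃ N, ∀ n, N ≤ n → ρ n ∉ S := by
  have hev : ∀ᶠ n in Filter.atTop, ∀ t ∈ S, ρ n ≠ t := by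
    rw [Filter.eventually_all_finite S.toFinite]
    intro t ht
    have hto : t ∉ infOcc ρ := fun h' => (h ▸ (⟨h', ht⟩ : t ∈ infOcc ρ ∩ S) : t ∈ (∅ : Set _))
    simp only [infOcc, Set.mem_ofPred_eq, not_forall, not_exists, not_and] at hto
    exact Filter.eventually_atTop.2 hto
  obtain ⟨N, hN⟩ := Filter.eventually_atTop.1 hev
  exact ⟨N, fun n hn hS => hN n hn _ hS rfl⟩

theorem mem_rfDelta {Q A : Type} {δ : Set (Q × A × Q)} {T : ℕ → ℕ → Set (Q × A × Q)} {m : ℕ}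
    {t : RFQ Q × A × RFQ Q} :
    t ∈ rfDelta δ T m ↔ (∃ q a q', (q, a, q') ∈ δ ∧ t = (Sum.inl q, a, Sum.inl q')) ∨
      ∃ i, 1 ≤ i ∧ i ≤ m ∧ (t ∈ copyDelta δ T i ∨ t ∈ copyBridge δ i) := by
  simp only [rfDelta, liftTr, Set.mem_union, Set.mem_image, Set.mem_iUnion, Finset.mem_Icc,
    Prod.exists, exists_prop, and_assoc, eq_comm]

/-- Forget which copy of `Q` a state of `removeFin` belongs to. -/
def baseState {Q : Type} : RFQ Q → Q := Sum.elim id Prod.snd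

theorem liftTr_baseState_mem {Q A : Type} {δ : Set (Q × A × Q)}
    {T : ℕ → ℕ → Set (Q × A × Q)} {m : ℕ} {t : RFQ Q × A × RFQ Q} (h : t ∈ rfDelta δ T m) :
    liftTr baseState t ∈ δ := by
  rcases mem_rfDelta.1 h with ⟨_, _, _, hδ, rfl⟩ | ⟨i, -, -, ⟨_, _, _, hδ, rfl⟩ | ⟨_, _, _, hδ, rfl⟩⟩
  · exact hδ
  · exact hδ.1
  · exact hδ

theorem mem_copyDelta_of_source {Q A : Type} {δ : Set (Q × A × Q)}
    {T : ℕ → ℕ → Set (Q × A × Q)} {m i : ℕ} {t : RFQ Q × A × RFQ Q} (h : t ∈ rfDelta δ T m)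
    {q : Q} (hq : t.1 = Sum.inr (i, q)) : t ∈ copyDelta δ T i := by
  rcases mem_rfDelta.1 h with ⟨_, _, _, _, rfl⟩ | ⟨i', -, -, h' | ⟨_, _, _, _, rfl⟩⟩
  · simp at hq
  · obtain ⟨_, _, _, _, rfl⟩ := id h'
    simp only [Sum.inr.injEq, Prod.mk.injEq] at hq
    exact hq.1 ▸ h'
  · simp at hq

theorem map_mem_infOcc {Q Q' A : Type} {ρ : ℕ → Q × A × Q} {ρ' : ℕ → Q' × A × Q'}
    {f : Q × A × Q → Q' × A × Q'} {N : ℕ} (hf : ∀ n, N ≤ n → ρ' n = f (ρ n))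
    {t : Q × A × Q} (ht : t ∈ infOcc ρ) : f t ∈ infOcc ρ' := by
  intro M
  obtain ⟨n, hn, rfl⟩ := ht (max M N)
  exact ⟨n, (le_max_left _ _).trans hn, hf n ((le_max_right _ _).trans hn)⟩

theorem exists_removeFin_run {Q A : Type} {δ : Set (Q × A × Q)} {I : Set Q} {m : ℕ}
    {k : ℕ → ℕ} {T : ℕ → ℕ → Set (Q × A × Q)} {acc : AccCond Q A} {u : ℕ → A}
    {ρ : ℕ → Q × A × Q} (hρ : TELA.IsRun ⟨δ, I, acc⟩ u ρ) {i N : ℕ} (hi : 1 ≤ i) (him : i ≤ m)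
    (hN : ∀ n, N ≤ n → ρ n ∉ T i 0) :
    ∃ ρ', (removeFin δ T I m k).IsRun u ρ' ∧
      ∀ n, N + 1 ≤ n → ρ' n = liftTr (fun q => Sum.inr (i, q)) (ρ n) := by
  let g : ℕ → Q → RFQ Q := fun n q => if n ≤ N then Sum.inl q else Sum.inr (i, q)
  refine ⟨fun n => (g n (ρ n).1, (ρ n).2.1, g (n + 1) (ρ n).2.2), ⟨?_, fun n => ⟨?_, ?_, ?_⟩⟩, ?_⟩
  · exact ⟨_, hρ.1, by simp [g]⟩
  · have hδ : ρ n ∈ δ := (hρ.2 n).1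
    refine mem_rfDelta.2 ?_
    rcases lt_trichotomy n N with h | h | h
    · exact Or.inl ⟨_, _, _, hδ, by simp [g, h.le, Nat.succ_le_of_lt h]⟩
    · exact Or.inr ⟨i, hi, him, Or.inr ⟨_, _, _, hδ, by simp [g, h]⟩⟩
    · refine Or.inr ⟨i, hi, him, Or.inl ⟨_, _, _, ⟨hδ, hN n h.le⟩, ?_⟩⟩
      simp [g, h.not_ge, (h.trans n.lt_succ_self).not_ge]
  · exact (hρ.2 n).2.1
  · exact congrArg (g (n + 1)) (hρ.2 n).2.2
  · intro n hn
    simp [g, liftTr, show ¬ n ≤ N by omega, show ¬ n + 1 ≤ N by omega]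

theorem exists_forall_ge_mem_copyDelta {Q A : Type} {δ : Set (Q × A × Q)} {I : Set Q} {m : ℕ}
    {k : ℕ → ℕ} {T : ℕ → ℕ → Set (Q × A × Q)} {u : ℕ → A} {ρ : ℕ → RFQ Q × A × RFQ Q}
    (hρ : (removeFin δ T I m k).IsRun u ρ) {i j : ℕ}
    (h : (infOcc ρ ∩ copyU T i j).Nonempty) :
    ∃ N, ∀ n, N ≤ n → ρ n ∈ copyDelta δ T i := by
  obtain ⟨t, ht, q, a, q', -, rfl⟩ := h
  obtain ⟨N, -, hN⟩ := ht 0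
  refine ⟨N, fun n hn => ?_⟩
  induction n, hn using Nat.le_induction with
  | base => exact mem_copyDelta_of_source (hρ.2 N).1 (congrArg Prod.fst hN)
  | succ n _ ih =>
    obtain ⟨p, b, p', -, hp⟩ := ih
    refine mem_copyDelta_of_source (hρ.2 (n + 1)).1 (q := p') ?_
    rw [← (hρ.2 n).2.2, hp]

/-- For a TELA `A` in DNF, `L(A) = L(removeFin(A))`. -/
theorem lang_removeFin {Q A : Type} [Finite Q] [Finite A]
    (δ : Set (Q × A × Q)) (I : Set Q)
    (m : ℕ) (k : ℕ → ℕ) (T : ℕ → ℕ → Set (Q × A × Q))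
    (hm : 1 ≤ m) (hk : ∀ i, 1 ≤ i → i ≤ m → 1 ≤ k i)
    (hT : ∀ i j, 1 ≤ i → i ≤ m → j ≤ k i → T i j ⊆ δ) :
    TELA.Lang ⟨δ, I, dnfAcc m k T⟩ = (removeFin δ T I m k).Lang := by
  ext u
  constructor
  · rintro ⟨ρ, hρ, hacc⟩
    obtain ⟨i, hi, him, hfin, hinf⟩ := (sat_bigOrN _ _ _).1 hacc
    obtain ⟨N, hN⟩ := exists_forall_ge_notMem_of_infOcc_inter_eq_empty hfin
    obtain ⟨ρ', hρ', hlift⟩ := exists_removeFin_run (k := k) hρ hi him hN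
    refine ⟨ρ', hρ', (sat_bigOrN _ _ _).2 ⟨i, hi, him, (sat_infConj _ _ _).2 fun j hj hjk => ?_⟩⟩
    obtain ⟨t, ht, htj⟩ := (sat_infConj _ _ _).1 hinf j hj hjk
    have ht0 : t ∉ T i 0 := by
      obtain ⟨n, hn, rfl⟩ := ht N
      exact hN n hn
    exact ⟨_, map_mem_infOcc hlift ht, _, _, _, ⟨htj, ht0⟩, rfl⟩
  · rintro ⟨ρ, hρ, hacc⟩
    obtain ⟨i, hi, him, hinf⟩ := (sat_bigOrN _ _ _).1 hacc
    replace hinf := (sat_infConj _ _ _).1 hinf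
    obtain ⟨N, hN⟩ := exists_forall_ge_mem_copyDelta hρ (hinf 1 le_rfl (hk i hi him))
    refine ⟨fun n => liftTr baseState (ρ n), ⟨?_, fun n => ⟨?_, ?_, ?_⟩⟩,
      (sat_bigOrN _ _ _).2 ⟨i, hi, him, ?_, (sat_infConj _ _ _).2 fun j hj hjk => ?_⟩⟩
    · obtain ⟨q, hq, hq0⟩ := hρ.1
      simpa [liftTr, ← hq0, baseState] using hq
    · exact liftTr_baseState_mem (hρ.2 n).1
    · exact (hρ.2 n).2.1
    · exact congrArg baseState (hρ.2 n).2.2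
    · refine Set.eq_empty_of_forall_notMem ?_
      rintro t ⟨ht, ht0⟩
      obtain ⟨n, hn, rfl⟩ := ht N
      obtain ⟨q, a, q', hq, hρn⟩ := hN n hn
      simp only [hρn] at ht0
      exact hq.2 ht0
    · obtain ⟨t, ht, q, a, q', hq, rfl⟩ := hinf j hj hjk
      exact ⟨_, map_mem_infOcc (N := 0) (fun _ _ => rfl) ht, hq.1⟩

end TELAFormal
end

section
/- Let A = (Q,Σ,δ,I,α) be a TELA, call a state q deterministic if for every a ∈ Σ there is at most one q' with (q,a,q') ∈ δ, and let Q_D* = {q ∈ Q | every state reachable from q is deterministic} and Q_N* = Q ∖ Q_D*. Then A is limit-deterministic if and only if the partition Q_N*, Q_D* satisfies conditions (1)–(3) of the definition of limit-determinism. -/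
namespace TELAFormal

variable {Q A : Type}

/-- Reachability along transitions of `δ` (reflexive-transitive). -/
def Reach (δ : Set (Q × A × Q)) : Q → Q → Prop :=
  Relation.ReflTransGen (fun q q' => ∃ a, (q, a, q') ∈ δ)

/-- A state is deterministic if it has at most one `a`-successor for every `a`. -/
def DetState (δ : Set (Q × A × Q)) (q : Q) : Prop :=
  ∀ a q₁ q₂, (q, a, q₁) ∈ δ → (q, a, q₂) ∈ δ → q₁ = q₂

/-- `Q_D* = {q | every state reachable from q is deterministic}`. -/
def QDstar (δ : Set (Q × A × Q)) : Set Q :=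
  {q | ∀ q', Reach δ q q' → DetState δ q'}

/-- No transition leaves `QDstar δ`. -/
theorem mem_QDstar_of_mem_delta {δ : Set (Q × A × Q)} {t : Q × A × Q} (ht : t ∈ δ)
    (h : t.1 ∈ QDstar δ) : t.2.2 ∈ QDstar δ :=
  fun q hq => h q (Relation.ReflTransGen.head ⟨t.2.1, ht⟩ hq)

/-- `QDstar δ` contains every set of deterministic states that is closed under transitions. -/
theorem subset_QDstar {δ : Set (Q × A × Q)} {D : Set Q}
    (hclosed : ∀ t ∈ δ, t.1 ∈ D → t.2.2 ∈ D) (hdet : ∀ q ∈ D, DetState δ q) :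
    D ⊆ QDstar δ := by
  intro q hq q' hreach
  refine hdet q' ?_
  induction hreach with
  | refl => exact hq
  | tail _ hstep ih =>
    obtain ⟨a, ha⟩ := hstep
    exact hclosed _ ha ih

/-- A TELA is limit-deterministic iff the canonical partition
`Q_N* = (Q_D*)ᶜ`, `Q_D*` satisfies conditions (1)–(3) of the definition of
limit-determinism. -/
theorem limitDet_iff_canonical_partition {Q A : Type} [Finite Q] [Finite A]
    (M : TELA Q A) (hwf : M.acc.wf M.delta) :
    M.LimitDet ↔
      ((∀ t ∈ M.delta, t.1 ∈ QDstar M.delta → t.2.2 ∈ QDstar M.delta) ∧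
       (∀ q ∈ QDstar M.delta, ∀ a q₁ q₂,
          (q, a, q₁) ∈ M.delta → (q, a, q₂) ∈ M.delta → q₁ = q₂) ∧
       (∀ u ρ, M.IsRun u ρ → AccCond.sat (infOcc ρ) M.acc →
          infOcc ρ ∩ {t | t.1 ∉ QDstar M.delta ∧ t.2.2 ∉ QDstar M.delta} = ∅)) := by
  refine ⟨?_, fun h => ⟨QDstar M.delta, h⟩⟩
  rintro ⟨QD, hclosed, hdet, hacc⟩
  refine ⟨fun t ht => mem_QDstar_of_mem_delta ht, fun q hq => hq q .refl, ?_⟩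
  intro u ρ hρ hsat
  have hsub := subset_QDstar hclosed hdet
  refine Set.subset_empty_iff.1 ?_
  rw [← hacc u ρ hρ hsat]
  exact Set.inter_subset_inter_right _ fun t ht =>
    ⟨fun h => ht.1 (hsub h), fun h => ht.2 (hsub h)⟩

end TELAFormal
end

section
/- Let A = (Q, Σ, δ, I, α) be a TELA in DNF and let ρ = t₀t₁… with t_l = (q_l, w_l, q_{l+1}) be an accepting run of A on w = w₀w₁…. Then there exist 1 ≤ i ≤ m with inf(ρ) ⊨ α_i and K ≥ 0 such that: (a) for all l ≥ K, t_l ∉ T^i_0; and (b) for all l ≥ K there exists m' > l such that θ_i({q_l}, w[l..m']) = θ_i({q_K}, w[K..m']). -/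
namespace TELAFormal

variable {Q A : Type}

/-- Subset transition function: `theta δ' P a` is the set of `a`-successors of
states in `P` via transitions in `δ'`. -/
def theta (δ' : Set (Q × A × Q)) (P : Set Q) (a : A) : Set Q :=
  {q' | ∃ q ∈ P, (q, a, q') ∈ δ'}

/-- `thetaSeg δ' w P l n` applies `theta δ'` to `P` along the letters
`w l, w (l+1), …, w (l+n-1)`, i.e. the segment `w[l..l+n-1]` of length `n`. -/
def thetaSeg (δ' : Set (Q × A × Q)) (w : ℕ → A) (P : Set Q) (l : ℕ) : ℕ → Set Q
  | 0 => P
  | n+1 => theta δ' (thetaSeg δ' w P l n) (w (l + n))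

/-- A satisfied finite disjunction has a satisfied disjunct. -/
theorem exists_sat_of_sat_bigOrN {S : Set (Q × A × Q)} {f : ℕ → AccCond Q A} :
    ∀ {m : ℕ}, (bigOrN f m).sat S → ∃ i, 1 ≤ i ∧ i ≤ m ∧ (f i).sat S
  | 0, h => h.elim
  | 1, h => ⟨1, le_rfl, le_rfl, h⟩
  | n + 2, h => by
    rcases h with h | h
    · obtain ⟨i, h1, h2, h3⟩ := exists_sat_of_sat_bigOrN h
      exact ⟨i, h1, by omega, h3⟩
    · exact ⟨n + 2, by omega, le_rfl, h⟩

/-- A set of transitions disjoint from `infOcc ρ` is eventually avoided by `ρ`. -/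
theorem exists_forall_notMem_of_infOcc_inter_eq_empty [Finite Q] [Finite A]
    {ρ : ℕ → Q × A × Q} {S : Set (Q × A × Q)} (h : infOcc ρ ∩ S = ∅) :
    ∃ K, ∀ l, K ≤ l → ρ l ∉ S := by
  have hev : ∀ t : Q × A × Q, ∀ᶠ n in Filter.atTop, ρ n = t → t ∉ S := by
    intro t
    by_cases ht : t ∈ S
    · have hnot : t ∉ infOcc ρ := fun hi => (h ▸ (⟨hi, ht⟩ : t ∈ infOcc ρ ∩ S) : t ∈ (∅ : Set _))
      simp only [infOcc, Set.mem_ofPred_eq, not_forall, not_exists, not_and] at hnot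
      obtain ⟨N, hN⟩ := hnot
      exact Filter.eventually_atTop.2 ⟨N, fun n hn he => (hN n hn he).elim⟩
    · exact Filter.Eventually.of_forall fun _ _ => ht
  obtain ⟨K, hK⟩ := Filter.eventually_atTop.1 (Filter.eventually_all.2 hev)
  exact ⟨K, fun l hl => hK l hl (ρ l) rfl⟩

theorem thetaSeg_mono {δ' : Set (Q × A × Q)} {w : ℕ → A} {P P' : Set Q} (h : P ⊆ P') (l n : ℕ) :
    thetaSeg δ' w P l n ⊆ thetaSeg δ' w P' l n := by
  induction n with
  | zero => exact h
  | succ n ih =>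
    rintro q' ⟨q, hq, hδ⟩
    exact ⟨q, ih hq, hδ⟩

theorem thetaSeg_add (δ' : Set (Q × A × Q)) (w : ℕ → A) (P : Set Q) (l a b : ℕ) :
    thetaSeg δ' w P l (a + b) = thetaSeg δ' w (thetaSeg δ' w P l a) (l + a) b := by
  induction b with
  | zero => rfl
  | succ b ih => rw [← Nat.add_assoc, thetaSeg, thetaSeg, ih, Nat.add_assoc]

/-- A path through `δ'` from position `l` on stays inside the reachable sets. -/
theorem mem_thetaSeg_of_path {δ' : Set (Q × A × Q)} {w : ℕ → A} {q : ℕ → Q} {l : ℕ}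
    (h : ∀ n, l ≤ n → (q n, w n, q (n + 1)) ∈ δ') (n : ℕ) :
    q (l + n) ∈ thetaSeg δ' w {q l} l n := by
  induction n with
  | zero => rfl
  | succ n ih => exact ⟨q (l + n), ih, h _ (Nat.le_add_right _ _)⟩

/-- Starting later along a path yields smaller reachable sets. -/
theorem thetaSeg_subset_of_path {δ' : Set (Q × A × Q)} {w : ℕ → A} {q : ℕ → Q} {K l n : ℕ}
    (h : ∀ n, K ≤ n → (q n, w n, q (n + 1)) ∈ δ') (hKl : K ≤ l) (hln : l ≤ n) :
    thetaSeg δ' w {q l} l (n - l) ⊆ thetaSeg δ' w {q K} K (n - K) := by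
  obtain ⟨a, rfl⟩ := Nat.exists_eq_add_of_le hKl
  obtain ⟨b, rfl⟩ := Nat.exists_eq_add_of_le hln
  rw [Nat.add_sub_cancel_left, Nat.add_assoc, Nat.add_sub_cancel_left, thetaSeg_add]
  exact thetaSeg_mono (Set.singleton_subset_iff.2 (mem_thetaSeg_of_path h a)) _ _

/-- Along a path through `δ'` from position `N` on, some position `K` is such that the set
reachable from `q K` coincides at some point with the one reachable from any later `q l`. -/
theorem exists_thetaSeg_eq_of_path [Finite Q] {δ' : Set (Q × A × Q)} {w : ℕ → A} {q : ℕ → Q}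
    {N : ℕ} (h : ∀ n, N ≤ n → (q n, w n, q (n + 1)) ∈ δ') :
    ∃ K, N ≤ K ∧ ∀ l, K ≤ l → ∃ m, l < m ∧
      thetaSeg δ' w {q l} l (m - l + 1) = thetaSeg δ' w {q K} K (m - K + 1) := by
  classical
  have hex : ∃ c, ∃ K, N ≤ K ∧ ∃ M, ∀ n, M ≤ n →
      (thetaSeg δ' w {q K} K (n - K)).ncard ≤ c :=
    ⟨Nat.card Q, N, le_rfl, 0, fun n _ => Set.ncard_le_card _⟩
  obtain ⟨K, hNK, M, hM⟩ := Nat.find_spec hex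
  refine ⟨K, hNK, fun l hl => ?_⟩
  obtain ⟨n, hn, hcard⟩ : ∃ n, max M (l + 2) ≤ n ∧
      Nat.find hex ≤ (thetaSeg δ' w {q l} l (n - l)).ncard := by
    by_contra! hlt
    have hpos := hlt _ le_rfl
    exact Nat.find_min hex (m := Nat.find hex - 1) (by omega)
      ⟨l, hNK.trans hl, max M (l + 2), fun n hn => Nat.le_sub_one_of_lt (hlt n hn)⟩
  have hMn : M ≤ n := (le_max_left _ _).trans hn
  have hln : l + 2 ≤ n := (le_max_right _ _).trans hn
  refine ⟨n - 1, by omega, ?_⟩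
  rw [show n - 1 - l + 1 = n - l by omega, show n - 1 - K + 1 = n - K by omega]
  exact Set.eq_of_subset_of_ncard_le
    (thetaSeg_subset_of_path (fun n hn => h n (hNK.trans hn)) hl (by omega))
    ((hM n hMn).trans hcard)

/-- Let `A` be a TELA in DNF and `ρ` an accepting run of `A`
on `w`. Then there are a disjunct `i` with `inf(ρ) ⊨ α_i` and `K ≥ 0` such
that (a) for all `l ≥ K` the transition `ρ l` is not in `T i 0`, and (b) for
all `l ≥ K` there is `m' > l` with
`θᵢ({q_l}, w[l..m']) = θᵢ({q_K}, w[K..m'])`, where `q_l = (ρ l).1` and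
`θᵢ = θ|_{δ ∖ T i 0}`. -/
theorem accepting_run_breakpoint_lemma {Q A : Type} [Finite Q] [Finite A]
    (δ : Set (Q × A × Q)) (I : Set Q)
    (m : ℕ) (k : ℕ → ℕ) (T : ℕ → ℕ → Set (Q × A × Q))
    (hm : 1 ≤ m) (hk : ∀ i, 1 ≤ i → i ≤ m → 1 ≤ k i)
    (hT : ∀ i j, 1 ≤ i → i ≤ m → j ≤ k i → T i j ⊆ δ)
    (w : ℕ → A) (ρ : ℕ → Q × A × Q)
    (hrun : TELA.IsRun ⟨δ, I, dnfAcc m k T⟩ w ρ)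
    (hacc : AccCond.sat (infOcc ρ) (dnfAcc m k T)) :
    ∃ i, 1 ≤ i ∧ i ≤ m ∧
      AccCond.sat (infOcc ρ) (.conj (.fin (T i 0)) (infConj (T i) (k i))) ∧
      ∃ K, (∀ l, K ≤ l → ρ l ∉ T i 0) ∧
        (∀ l, K ≤ l → ∃ m', l < m' ∧
          thetaSeg (δ \ T i 0) w {(ρ l).1} l (m' - l + 1) =
            thetaSeg (δ \ T i 0) w {(ρ K).1} K (m' - K + 1)) := by
  obtain ⟨i, h1, him, hsat⟩ := exists_sat_of_sat_bigOrN hacc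
  obtain ⟨N, hN⟩ := exists_forall_notMem_of_infOcc_inter_eq_empty hsat.1
  have hpath : ∀ n, N ≤ n → ((ρ n).1, w n, (ρ (n + 1)).1) ∈ δ \ T i 0 := by
    intro n hn
    obtain ⟨hδ, hw, hq⟩ := hrun.2 n
    rw [← hw, ← hq]
    exact ⟨hδ, hN n hn⟩
  obtain ⟨K, hNK, hK⟩ := exists_thetaSeg_eq_of_path (q := fun n => (ρ n).1) hpath
  exact ⟨i, h1, him, hsat, K, fun l hl => hN l (hNK.trans hl), hK⟩

end TELAFormal
end
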